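/- arXiv:2510.09042 — 6 statements merged into one kernel-verified Lean document; each statement's English description precedes it below -/
import Mathlib

section
/- Let p, q ≥ 1, let M ∈ ℝ^{p×q}, z ∈ ℝ^q, and let λ ≥ 0 and α satisfy 0 < α < 2 and λ zᵀz ≤ 2 − α. Set e = M z and M' = M − λ · e zᵀ. Then tr(M'ᵀ M') ≤ tr(Mᵀ M) − λ α ‖e‖². -/
open Matrix

/-- For `M ∈ ℝ^{p×q}`, `z ∈ ℝ^q`, `λ ≥ 0`, `0 < α < 2`, `λ zᵀz ≤ 2 − α`, with
`e = M z` and `M' = M − λ e zᵀ`, we have `tr(M'ᵀ M') ≤ tr(Mᵀ M) − λ α ‖e‖²`. -/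
theorem trace_update_descent (p q : ℕ) (hp : 1 ≤ p) (hq : 1 ≤ q)
    (M : Matrix (Fin p) (Fin q) ℝ) (z : Fin q → ℝ) (lam α : ℝ)
    (hlam : 0 ≤ lam) (hα : 0 < α) (hα2 : α < 2)
    (hlz : lam * (z ⬝ᵥ z) ≤ 2 - α)
    (e : Fin p → ℝ) (he : e = M.mulVec z)
    (M' : Matrix (Fin p) (Fin q) ℝ) (hM' : M' = M - lam • vecMulVec e z) :
    (M'ᵀ * M').trace ≤ (Mᵀ * M).trace - lam * α * (e ⬝ᵥ e) := by
  have tr : ∀ A : Matrix (Fin p) (Fin q) ℝ, (Aᵀ * A).trace = ∑ i, ∑ j, A i j * A i j := by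
    intro A
    simp only [Matrix.trace, Matrix.diag_apply, Matrix.mul_apply, Matrix.transpose_apply]
    exact Finset.sum_comm
  have row : ∀ i, ∑ j, M' i j * M' i j
      = ∑ j, M i j * M i j + (lam ^ 2 * (z ⬝ᵥ z) - 2 * lam) * (e i * e i) := by
    intro i
    have h1 : e i = ∑ j, M i j * z j := by rw [he]; rfl
    have h2 : ∑ j, M' i j * M' i j = ∑ j, M i j * M i j
        - 2 * lam * e i * (∑ j, M i j * z j) + lam ^ 2 * (e i * e i) * (∑ j, z j * z j) := by
      rw [Finset.mul_sum, Finset.mul_sum, ← Finset.sum_sub_distrib, ← Finset.sum_add_distrib]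
      refine Finset.sum_congr rfl fun j _ => ?_
      simp only [hM', Matrix.sub_apply, Matrix.smul_apply, Matrix.vecMulVec_apply, smul_eq_mul]
      ring
    rw [h2, ← h1]
    simp only [dotProduct]
    ring
  have hee : 0 ≤ e ⬝ᵥ e := Finset.sum_nonneg fun i _ => mul_self_nonneg (e i)
  have key : (M'ᵀ * M').trace
      = (Mᵀ * M).trace + (lam ^ 2 * (z ⬝ᵥ z) - 2 * lam) * (e ⬝ᵥ e) := by
    rw [tr, tr, Finset.sum_congr rfl fun i _ => row i, Finset.sum_add_distrib,
      ← Finset.mul_sum]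
    rfl
  rw [key]
  have h3 := mul_le_mul_of_nonneg_left hlz (mul_nonneg hlam hee)
  nlinarith [h3]
end

section
/- Under the nominal adaptation setting, for every k ≥ 1 the Lyapunov function satisfies the descent inequality V_{k+1} ≤ V_k − λ_k α (‖g̃_{k+1}‖² + ‖x̃_{k+1}‖²). -/
open Matrix

theorem trace_rank_one_update {p q : ℕ} (A : Matrix (Fin p) (Fin q) ℝ) (v : Fin q → ℝ)
    (e : Fin p → ℝ) (he : e = A.mulVec v) (l : ℝ) :
    ((A - l • vecMulVec e v)ᵀ * (A - l • vecMulVec e v)).trace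
      = (Aᵀ * A).trace - 2 * l * (e ⬝ᵥ e) + l ^ 2 * ((e ⬝ᵥ e) * (v ⬝ᵥ v)) := by
  have h1 : e ⬝ᵥ e = ∑ i, ∑ j, e i * (A i j * v j) := by
    conv_lhs => rw [dotProduct]
    refine Finset.sum_congr rfl fun i _ => ?_
    rw [← Finset.mul_sum]
    congr 1
    rw [he]; rfl
  have h2 : (e ⬝ᵥ e) * (v ⬝ᵥ v) = ∑ i, ∑ j, (e i * e i) * (v j * v j) := by
    rw [dotProduct, dotProduct, Finset.sum_mul_sum]
  have h3 : ∀ B : Matrix (Fin p) (Fin q) ℝ, (Bᵀ * B).trace = ∑ i, ∑ j, B i j * B i j := by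
    intro B
    rw [Finset.sum_comm]
    rfl
  rw [h2, h1, h3, h3]
  simp only [Finset.mul_sum, ← Finset.sum_sub_distrib, ← Finset.sum_add_distrib]
  refine Finset.sum_congr rfl fun i _ => Finset.sum_congr rfl fun j _ => ?_
  simp only [Matrix.sub_apply, Matrix.smul_apply, vecMulVec_apply, smul_eq_mul]
  ring

theorem trace_descent {p q : ℕ} (A : Matrix (Fin p) (Fin q) ℝ) (v : Fin q → ℝ)
    (e : Fin p → ℝ) (he : e = A.mulVec v) (l α : ℝ) (hl : 0 ≤ l) (hv : v ≠ 0)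
    (hle : l ≤ (2 - α) / (v ⬝ᵥ v)) :
    ((A - l • vecMulVec e v)ᵀ * (A - l • vecMulVec e v)).trace
      ≤ (Aᵀ * A).trace - l * α * (e ⬝ᵥ e) := by
  rw [trace_rank_one_update A v e he l]
  have hee : 0 ≤ e ⬝ᵥ e := Finset.sum_nonneg fun i _ => mul_self_nonneg _
  have hvv : 0 < v ⬝ᵥ v :=
    lt_of_le_of_ne (Finset.sum_nonneg fun i _ => mul_self_nonneg _)
      fun h0 => hv (dotProduct_self_eq_zero.mp h0.symm)
  rw [le_div_iff₀ hvv] at hle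
  have := mul_le_mul_of_nonneg_left hle (mul_nonneg hl hee)
  nlinarith

/-- Nominal adaptation: the Lyapunov function satisfies the descent inequality
`V_{k+1} ≤ V_k − λ_k α (‖g̃_{k+1}‖² + ‖x̃_{k+1}‖²)` for all `k ≥ 1`. -/
theorem nominal_lyapunov_descent
    (h n m : ℕ) (hh : 1 ≤ h) (hn : 1 ≤ n) (hm : 1 ≤ m)
    (α : ℝ) (hα : 0 < α) (hα2 : α < 2)
    (Ψ : Matrix (Fin h) (Fin (h + m)) ℝ) (C : Matrix (Fin n) (Fin h) ℝ)
    (X : ℕ → Fin (h + m) → ℝ) (g : ℕ → Fin h → ℝ) (x : ℕ → Fin n → ℝ)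
    (hgdyn : ∀ k ≥ 1, g (k + 1) = Ψ.mulVec (X k))
    (hxdyn : ∀ k ≥ 1, x (k + 1) = C.mulVec (g (k + 1)))
    (hXne : ∀ k ≥ 1, X k ≠ 0) (hgne : ∀ k ≥ 1, g (k + 1) ≠ 0)
    (Ψhat : ℕ → Matrix (Fin h) (Fin (h + m)) ℝ) (Chat : ℕ → Matrix (Fin n) (Fin h) ℝ)
    (gt : ℕ → Fin h → ℝ) (xt : ℕ → Fin n → ℝ) (lam : ℕ → ℝ)
    (hgt : ∀ k ≥ 1, gt (k + 1) = g (k + 1) - (Ψhat k).mulVec (X k))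
    (hxt : ∀ k ≥ 1, xt (k + 1) = x (k + 1) - (Chat k).mulVec (g (k + 1)))
    (hlam : ∀ k ≥ 1, lam k =
      min ((2 - α) / (X k ⬝ᵥ X k)) ((2 - α) / (g (k + 1) ⬝ᵥ g (k + 1))))
    (hΨup : ∀ k ≥ 1, Ψhat (k + 1) = Ψhat k + lam k • vecMulVec (gt (k + 1)) (X k))
    (hCup : ∀ k ≥ 1, Chat (k + 1) = Chat k + lam k • vecMulVec (xt (k + 1)) (g (k + 1)))
    (V : ℕ → ℝ)
    (hV : ∀ k ≥ 1, V k = ((Ψ - Ψhat k)ᵀ * (Ψ - Ψhat k)).trace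
        + ((C - Chat k)ᵀ * (C - Chat k)).trace) :
    ∀ k ≥ 1, V (k + 1) ≤ V k
      - lam k * α * ((gt (k + 1) ⬝ᵥ gt (k + 1)) + (xt (k + 1) ⬝ᵥ xt (k + 1))) := by
  intro k hk
  have hX0 : 0 ≤ X k ⬝ᵥ X k := Finset.sum_nonneg fun i _ => mul_self_nonneg _
  have hg0 : 0 ≤ g (k + 1) ⬝ᵥ g (k + 1) := Finset.sum_nonneg fun i _ => mul_self_nonneg _
  have hl : 0 ≤ lam k := by
    rw [hlam k hk]
    exact le_min (div_nonneg (by linarith) hX0) (div_nonneg (by linarith) hg0)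
  have h1 := trace_descent (Ψ - Ψhat k) (X k) (gt (k + 1))
    (by rw [hgt k hk, Matrix.sub_mulVec, hgdyn k hk]) (lam k) α hl (hXne k hk)
    ((hlam k hk).le.trans (min_le_left _ _))
  have h2 := trace_descent (C - Chat k) (g (k + 1)) (xt (k + 1))
    (by rw [hxt k hk, Matrix.sub_mulVec, hxdyn k hk]) (lam k) α hl (hgne k hk)
    ((hlam k hk).le.trans (min_le_right _ _))
  rw [hV (k + 1) (by omega), hV k hk, hΨup k hk, hCup k hk, ← sub_sub, ← sub_sub]
  linarith
end

section
/- Under the nominal adaptation setting, for every k ≥ 1 the telescoped bound V_{k+1} ≤ V_1 − α · Σ_{i=1}^{k} λ_i (‖g̃_{i+1}‖² + ‖x̃_{i+1}‖²) holds. -/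
open Matrix

lemma trace_step_aux {p q : ℕ} (M : Matrix (Fin p) (Fin q) ℝ) (v : Fin q → ℝ)
    (e : Fin p → ℝ) (he : e = M.mulVec v) (l : ℝ) :
    ((M - l • vecMulVec e v)ᵀ * (M - l • vecMulVec e v)).trace
      = (Mᵀ * M).trace - 2 * l * (e ⬝ᵥ e) + l ^ 2 * (e ⬝ᵥ e) * (v ⬝ᵥ v) := by
  have key : ∀ A : Matrix (Fin p) (Fin q) ℝ,
      (Aᵀ * A).trace = ∑ i, ∑ j, A i j * A i j := by
    intro A
    simp only [Matrix.trace, Matrix.diag, Matrix.mul_apply, Matrix.transpose_apply]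
    exact Finset.sum_comm
  rw [key, key]
  have row : ∀ i, ∑ j, (M - l • vecMulVec e v) i j * (M - l • vecMulVec e v) i j
      = ∑ j, M i j * M i j - 2 * l * (e i * e i) + l ^ 2 * (e i * e i) * (v ⬝ᵥ v) := by
    intro i
    have h1 : e i = ∑ j, M i j * v j := by rw [he]; rfl
    have h2 : 2 * l * (e i * e i) = ∑ j, 2 * l * e i * (M i j * v j) := by
      rw [← Finset.mul_sum, ← h1]; ring
    rw [h2, dotProduct, Finset.mul_sum, ← Finset.sum_sub_distrib, ← Finset.sum_add_distrib]
    refine Finset.sum_congr rfl fun j _ => ?_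
    simp only [Matrix.sub_apply, Matrix.smul_apply, vecMulVec_apply, smul_eq_mul]
    ring
  rw [Finset.sum_congr rfl fun i _ => row i, Finset.sum_add_distrib, Finset.sum_sub_distrib,
    ← Finset.sum_mul, ← Finset.mul_sum, ← Finset.mul_sum]
  rfl

lemma trace_step_le {p q : ℕ} (M : Matrix (Fin p) (Fin q) ℝ) (v : Fin q → ℝ)
    (e : Fin p → ℝ) (he : e = M.mulVec v) (l α : ℝ) (hl : 0 ≤ l)
    (hlv : l * (v ⬝ᵥ v) ≤ 2 - α) :
    ((M - l • vecMulVec e v)ᵀ * (M - l • vecMulVec e v)).trace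
      ≤ (Mᵀ * M).trace - α * (l * (e ⬝ᵥ e)) := by
  rw [trace_step_aux M v e he l]
  have hee : 0 ≤ e ⬝ᵥ e := Finset.sum_nonneg fun i _ => mul_self_nonneg _
  have := mul_le_mul_of_nonneg_left hlv (mul_nonneg hl hee)
  linarith

lemma dot_self_pos_aux {q : ℕ} (v : Fin q → ℝ) (hv : v ≠ 0) : 0 < v ⬝ᵥ v := by
  have h0 : 0 ≤ v ⬝ᵥ v := Finset.sum_nonneg fun i _ => mul_self_nonneg _
  exact lt_of_le_of_ne h0 fun h => hv (dotProduct_self_eq_zero.mp h.symm)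

/-- Nominal adaptation: the Lyapunov function satisfies the descent inequality
`V_{k+1} ≤ V_k − λ_k α (‖g̃_{k+1}‖² + ‖x̃_{k+1}‖²)` for all `k ≥ 1`. -/
theorem nominal_lyapunov_telescoped
    (h n m : ℕ) (hh : 1 ≤ h) (hn : 1 ≤ n) (hm : 1 ≤ m)
    (α : ℝ) (hα : 0 < α) (hα2 : α < 2)
    (Ψ : Matrix (Fin h) (Fin (h + m)) ℝ) (C : Matrix (Fin n) (Fin h) ℝ)
    (X : ℕ → Fin (h + m) → ℝ) (g : ℕ → Fin h → ℝ) (x : ℕ → Fin n → ℝ)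
    (hgdyn : ∀ k ≥ 1, g (k + 1) = Ψ.mulVec (X k))
    (hxdyn : ∀ k ≥ 1, x (k + 1) = C.mulVec (g (k + 1)))
    (hXne : ∀ k ≥ 1, X k ≠ 0) (hgne : ∀ k ≥ 1, g (k + 1) ≠ 0)
    (Ψhat : ℕ → Matrix (Fin h) (Fin (h + m)) ℝ) (Chat : ℕ → Matrix (Fin n) (Fin h) ℝ)
    (gt : ℕ → Fin h → ℝ) (xt : ℕ → Fin n → ℝ) (lam : ℕ → ℝ)
    (hgt : ∀ k ≥ 1, gt (k + 1) = g (k + 1) - (Ψhat k).mulVec (X k))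
    (hxt : ∀ k ≥ 1, xt (k + 1) = x (k + 1) - (Chat k).mulVec (g (k + 1)))
    (hlam : ∀ k ≥ 1, lam k =
      min ((2 - α) / (X k ⬝ᵥ X k)) ((2 - α) / (g (k + 1) ⬝ᵥ g (k + 1))))
    (hΨup : ∀ k ≥ 1, Ψhat (k + 1) = Ψhat k + lam k • vecMulVec (gt (k + 1)) (X k))
    (hCup : ∀ k ≥ 1, Chat (k + 1) = Chat k + lam k • vecMulVec (xt (k + 1)) (g (k + 1)))
    (V : ℕ → ℝ)
    (hV : ∀ k ≥ 1, V k = ((Ψ - Ψhat k)ᵀ * (Ψ - Ψhat k)).trace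
        + ((C - Chat k)ᵀ * (C - Chat k)).trace) :
    ∀ k ≥ 1, V (k + 1) ≤ V 1 - α * ∑ i ∈ Finset.Icc 1 k,
      lam i * ((gt (i + 1) ⬝ᵥ gt (i + 1)) + (xt (i + 1) ⬝ᵥ xt (i + 1))) := by
  have step : ∀ k ≥ 1, V (k + 1) ≤ V k - α *
      (lam k * ((gt (k + 1) ⬝ᵥ gt (k + 1)) + (xt (k + 1) ⬝ᵥ xt (k + 1)))) := by
    intro k hk
    have hX := dot_self_pos_aux _ (hXne k hk)
    have hg := dot_self_pos_aux _ (hgne k hk)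
    have h2 : 0 < 2 - α := by linarith
    have hl0 : 0 ≤ lam k := by
      rw [hlam k hk]; exact le_min (by positivity) (by positivity)
    have hlX : lam k * (X k ⬝ᵥ X k) ≤ 2 - α := by
      rw [← le_div_iff₀ hX, hlam k hk]; exact min_le_left _ _
    have hlg : lam k * (g (k + 1) ⬝ᵥ g (k + 1)) ≤ 2 - α := by
      rw [← le_div_iff₀ hg, hlam k hk]; exact min_le_right _ _
    have a := trace_step_le (Ψ - Ψhat k) (X k) (gt (k + 1))
      (by rw [hgt k hk, Matrix.sub_mulVec, ← hgdyn k hk]) (lam k) α hl0 hlX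
    have b := trace_step_le (C - Chat k) (g (k + 1)) (xt (k + 1))
      (by rw [hxt k hk, Matrix.sub_mulVec, ← hxdyn k hk]) (lam k) α hl0 hlg
    rw [hV (k + 1) (by omega), hV k hk, hΨup k hk, hCup k hk, ← sub_sub, ← sub_sub]
    linarith
  intro k hk
  induction k, hk using Nat.le_induction with
  | base => simpa using step 1 le_rfl
  | succ k hk ih =>
    have := step (k + 1) (by omega)
    rw [Finset.sum_Icc_succ_top (by omega), mul_add]
    linarith
end

section
/- (Theorem 1.) Under the nominal adaptation setting, assume additionally that there exists M > 0 such that X_kᵀ X_k ≤ M and g_{k+1}ᵀ g_{k+1} ≤ M for all k ≥ 1. Then: (i) the sequence V_k is nonincreasing, so the parameter approximation errors Ψ̃_k and C̃_k are uniformly bounded (in particular tr(Ψ̃_kᵀ Ψ̃_k) ≤ V_1 and tr(C̃_kᵀ C̃_k) ≤ V_1 for all k); (ii) the series Σ_k (‖g̃_{k+1}‖² + ‖x̃_{k+1}‖²) converges, and consequently the observable prediction error g̃_{k+1} and the state prediction error x̃_{k+1} converge to zero as k → ∞. -/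
open Matrix

lemma trace_tmul_self_rows {p q : ℕ} (A : Matrix (Fin p) (Fin q) ℝ) :
    (Aᵀ * A).trace = ∑ i, (A i ⬝ᵥ A i) := by
  simp only [Matrix.trace, Matrix.diag, Matrix.mul_apply, Matrix.transpose_apply, dotProduct]
  exact Finset.sum_comm

lemma trace_update {p q : ℕ} (A : Matrix (Fin p) (Fin q) ℝ) (u : Fin q → ℝ) (l : ℝ) :
    ((A - l • vecMulVec (A.mulVec u) u)ᵀ * (A - l • vecMulVec (A.mulVec u) u)).trace
      = (Aᵀ * A).trace - 2 * l * (A.mulVec u ⬝ᵥ A.mulVec u)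
        + l ^ 2 * (A.mulVec u ⬝ᵥ A.mulVec u) * (u ⬝ᵥ u) := by
  rw [trace_tmul_self_rows, trace_tmul_self_rows]
  have hrow : ∀ i, (A - l • vecMulVec (A.mulVec u) u) i = A i - (l * (A i ⬝ᵥ u)) • u := by
    intro i
    ext j
    simp [vecMulVec_apply, Matrix.mulVec, mul_assoc]
  have he : A.mulVec u ⬝ᵥ A.mulVec u = ∑ i, (A i ⬝ᵥ u) * (A i ⬝ᵥ u) := rfl
  rw [he, Finset.mul_sum, Finset.mul_sum, Finset.sum_mul, ← Finset.sum_sub_distrib,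
    ← Finset.sum_add_distrib]
  refine Finset.sum_congr rfl fun i _ => ?_
  rw [hrow]
  simp only [sub_dotProduct, dotProduct_sub, smul_dotProduct, dotProduct_smul, smul_eq_mul,
    dotProduct_comm u (A i)]
  ring

lemma dot_self_nonneg {p : ℕ} (v : Fin p → ℝ) : 0 ≤ v ⬝ᵥ v :=
  Finset.sum_nonneg fun i _ => mul_self_nonneg (v i)

lemma dot_self_pos {p : ℕ} (v : Fin p → ℝ) (hv : v ≠ 0) : 0 < v ⬝ᵥ v :=
  lt_of_le_of_ne (dot_self_nonneg v) fun h0 => hv (dotProduct_self_eq_zero.mp h0.symm)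

lemma trace_nonneg_self {p q : ℕ} (A : Matrix (Fin p) (Fin q) ℝ) : 0 ≤ (Aᵀ * A).trace := by
  rw [trace_tmul_self_rows]
  exact Finset.sum_nonneg fun i _ => dot_self_nonneg (A i)

lemma tendsto_of_dot {p : ℕ} (v : ℕ → Fin p → ℝ) (b : ℕ → ℝ)
    (hb : Filter.Tendsto b Filter.atTop (nhds 0)) (hvb : ∀ k, v k ⬝ᵥ v k ≤ b k) :
    Filter.Tendsto v Filter.atTop (nhds 0) := by
  rw [tendsto_pi_nhds]
  intro i
  have h1 : Filter.Tendsto (fun k => Real.sqrt (b k)) Filter.atTop (nhds 0) := by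
    simpa using hb.sqrt
  refine squeeze_zero_norm (fun k => ?_) h1
  rw [Real.norm_eq_abs]
  apply Real.abs_le_sqrt
  refine le_trans ?_ (hvb k)
  rw [sq]
  exact Finset.single_le_sum (f := fun i => v k i * v k i)
    (fun j _ => mul_self_nonneg (v k j)) (Finset.mem_univ i)


/-- Nominal adaptation: the Lyapunov function satisfies the descent inequality
`V_{k+1} ≤ V_k − λ_k α (‖g̃_{k+1}‖² + ‖x̃_{k+1}‖²)` for all `k ≥ 1`. -/
theorem nominal_adaptation_convergence
    (h n m : ℕ) (hh : 1 ≤ h) (hn : 1 ≤ n) (hm : 1 ≤ m)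
    (α : ℝ) (hα : 0 < α) (hα2 : α < 2)
    (Ψ : Matrix (Fin h) (Fin (h + m)) ℝ) (C : Matrix (Fin n) (Fin h) ℝ)
    (X : ℕ → Fin (h + m) → ℝ) (g : ℕ → Fin h → ℝ) (x : ℕ → Fin n → ℝ)
    (hgdyn : ∀ k ≥ 1, g (k + 1) = Ψ.mulVec (X k))
    (hxdyn : ∀ k ≥ 1, x (k + 1) = C.mulVec (g (k + 1)))
    (hXne : ∀ k ≥ 1, X k ≠ 0) (hgne : ∀ k ≥ 1, g (k + 1) ≠ 0)
    (Ψhat : ℕ → Matrix (Fin h) (Fin (h + m)) ℝ) (Chat : ℕ → Matrix (Fin n) (Fin h) ℝ)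
    (gt : ℕ → Fin h → ℝ) (xt : ℕ → Fin n → ℝ) (lam : ℕ → ℝ)
    (hgt : ∀ k ≥ 1, gt (k + 1) = g (k + 1) - (Ψhat k).mulVec (X k))
    (hxt : ∀ k ≥ 1, xt (k + 1) = x (k + 1) - (Chat k).mulVec (g (k + 1)))
    (hlam : ∀ k ≥ 1, lam k =
      min ((2 - α) / (X k ⬝ᵥ X k)) ((2 - α) / (g (k + 1) ⬝ᵥ g (k + 1))))
    (hΨup : ∀ k ≥ 1, Ψhat (k + 1) = Ψhat k + lam k • vecMulVec (gt (k + 1)) (X k))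
    (hCup : ∀ k ≥ 1, Chat (k + 1) = Chat k + lam k • vecMulVec (xt (k + 1)) (g (k + 1)))
    (V : ℕ → ℝ)
    (hV : ∀ k ≥ 1, V k = ((Ψ - Ψhat k)ᵀ * (Ψ - Ψhat k)).trace
        + ((C - Chat k)ᵀ * (C - Chat k)).trace)
    (Mb : ℝ) (hMb : 0 < Mb)
    (hXb : ∀ k ≥ 1, X k ⬝ᵥ X k ≤ Mb) (hgb : ∀ k ≥ 1, g (k + 1) ⬝ᵥ g (k + 1) ≤ Mb) :
    (∀ k ≥ 1, V (k + 1) ≤ V k) ∧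
    (∀ k ≥ 1, ((Ψ - Ψhat k)ᵀ * (Ψ - Ψhat k)).trace ≤ V 1 ∧
        ((C - Chat k)ᵀ * (C - Chat k)).trace ≤ V 1) ∧
    Summable (fun k => (gt (k + 1) ⬝ᵥ gt (k + 1)) + (xt (k + 1) ⬝ᵥ xt (k + 1))) ∧
    Filter.Tendsto (fun k => gt (k + 1)) Filter.atTop (nhds 0) ∧
    Filter.Tendsto (fun k => xt (k + 1)) Filter.atTop (nhds 0) := by
  have hdesc : ∀ k ≥ 1, V (k + 1) ≤ V k - (2 - α) / Mb * α *
      ((gt (k + 1) ⬝ᵥ gt (k + 1)) + (xt (k + 1) ⬝ᵥ xt (k + 1))) := by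
    intro k hk
    have e1 : gt (k + 1) = (Ψ - Ψhat k).mulVec (X k) := by
      rw [hgt k hk, hgdyn k hk, Matrix.sub_mulVec]
    have e2 : xt (k + 1) = (C - Chat k).mulVec (g (k + 1)) := by
      rw [hxt k hk, hxdyn k hk, Matrix.sub_mulVec]
    have t1 := trace_update (Ψ - Ψhat k) (X k) (lam k)
    have t2 := trace_update (C - Chat k) (g (k + 1)) (lam k)
    rw [← e1, sub_sub, ← hΨup k hk] at t1
    rw [← e2, sub_sub, ← hCup k hk] at t2
    have hX := dot_self_pos _ (hXne k hk)
    have hg := dot_self_pos _ (hgne k hk)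
    have l1 : lam k * (X k ⬝ᵥ X k) ≤ 2 - α := by
      rw [← le_div_iff₀ hX, hlam k hk]; exact min_le_left _ _
    have l2 : lam k * (g (k + 1) ⬝ᵥ g (k + 1)) ≤ 2 - α := by
      rw [← le_div_iff₀ hg, hlam k hk]; exact min_le_right _ _
    have hc : (2 - α) / Mb ≤ lam k := by
      rw [hlam k hk]
      exact le_min (div_le_div_of_nonneg_left (by linarith) hX (hXb k hk))
        (div_le_div_of_nonneg_left (by linarith) hg (hgb k hk))
    have hl : 0 ≤ lam k := le_trans (div_nonneg (by linarith) hMb.le) hc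
    rw [hV k hk, hV (k + 1) (by omega), t1, t2]
    have hG := dot_self_nonneg (gt (k + 1))
    have hY := dot_self_nonneg (xt (k + 1))
    have a1 := mul_le_mul_of_nonneg_left l1 (mul_nonneg hl hG)
    have a2 := mul_le_mul_of_nonneg_left l2 (mul_nonneg hl hY)
    have a3 := mul_le_mul_of_nonneg_right hc (mul_nonneg hα.le (add_nonneg hG hY))
    linarith
  have hS : ∀ k, 0 ≤ (gt (k + 1) ⬝ᵥ gt (k + 1)) + (xt (k + 1) ⬝ᵥ xt (k + 1)) := fun k =>
    add_nonneg (dot_self_nonneg _) (dot_self_nonneg _)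
  have hc : 0 < (2 - α) / Mb * α := mul_pos (div_pos (by linarith) hMb) hα
  have hmono : ∀ k ≥ 1, V (k + 1) ≤ V k := fun k hk => by
    have := hdesc k hk
    have := mul_nonneg hc.le (hS k)
    linarith
  have hV1 : ∀ k ≥ 1, V k ≤ V 1 := by
    intro k hk
    induction k, hk using Nat.le_induction with
    | base => exact le_rfl
    | succ k hk ih => exact (hmono k hk).trans ih
  have hsum : Summable (fun k => (gt (k + 1) ⬝ᵥ gt (k + 1)) + (xt (k + 1) ⬝ᵥ xt (k + 1))) := by
    rw [← summable_nat_add_iff 1]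
    refine summable_of_sum_range_le (c := V 1 / ((2 - α) / Mb * α)) (fun k => hS (k + 1)) ?_
    intro N
    rw [le_div_iff₀ hc]
    have key : (∑ k ∈ Finset.range N, ((gt (k + 1 + 1) ⬝ᵥ gt (k + 1 + 1))
        + (xt (k + 1 + 1) ⬝ᵥ xt (k + 1 + 1)))) * ((2 - α) / Mb * α) ≤ V 1 - V (N + 1) := by
      induction N with
      | zero => simp
      | succ N ih =>
        rw [Finset.sum_range_succ, add_mul]
        have := hdesc (N + 1) (by omega)
        linarith
    have hVN : 0 ≤ V (N + 1) := by
      rw [hV (N + 1) (by omega)]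
      exact add_nonneg (trace_nonneg_self _) (trace_nonneg_self _)
    linarith
  refine ⟨hmono, fun k hk => ?_, hsum, ?_, ?_⟩
  · have := hV1 k hk
    rw [hV k hk] at this
    have p1 := trace_nonneg_self (Ψ - Ψhat k)
    have p2 := trace_nonneg_self (C - Chat k)
    constructor <;> linarith
  · exact tendsto_of_dot _ _ hsum.tendsto_atTop_zero fun k =>
      le_add_of_nonneg_right (dot_self_nonneg _)
  · exact tendsto_of_dot _ _ hsum.tendsto_atTop_zero fun k =>
      le_add_of_nonneg_left (dot_self_nonneg _)
end

section
/- Let p, q ≥ 1, let M ∈ ℝ^{p×q}, z ∈ ℝ^q, and let e, w* ∈ ℝ^p satisfy ⟨M z, e − w*⟩ ≥ ‖e − w*‖². Let λ ≥ 0 and 0 < α < 2 satisfy λ zᵀz ≤ 2 − α, and set M' = M − λ (e − w*) zᵀ. Then tr(M'ᵀ M') ≤ tr(Mᵀ M) − λ α ‖e − w*‖². -/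
open Matrix

/-- For `M ∈ ℝ^{p×q}`, `z ∈ ℝ^q`, `e, w* ∈ ℝ^p` with `⟨M z, e − w*⟩ ≥ ‖e − w*‖²`,
`λ ≥ 0`, `0 < α < 2`, `λ zᵀz ≤ 2 − α`, and `M' = M − λ (e − w*) zᵀ`, we have
`tr(M'ᵀ M') ≤ tr(Mᵀ M) − λ α ‖e − w*‖²`. -/
theorem trace_robust_update_descent (p q : ℕ) (hp : 1 ≤ p) (hq : 1 ≤ q)
    (M : Matrix (Fin p) (Fin q) ℝ) (z : Fin q → ℝ)
    (e wstar : Fin p → ℝ)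
    (hinner : (e - wstar) ⬝ᵥ (e - wstar) ≤ M.mulVec z ⬝ᵥ (e - wstar))
    (lam α : ℝ) (hlam : 0 ≤ lam) (hα : 0 < α) (hα2 : α < 2)
    (hlz : lam * (z ⬝ᵥ z) ≤ 2 - α)
    (M' : Matrix (Fin p) (Fin q) ℝ) (hM' : M' = M - lam • vecMulVec (e - wstar) z) :
    (M'ᵀ * M').trace ≤ (Mᵀ * M).trace - lam * α * ((e - wstar) ⬝ᵥ (e - wstar)) := by
  generalize e - wstar = d at *
  have key : (M'ᵀ * M').trace = (Mᵀ * M).trace - 2 * lam * (M.mulVec z ⬝ᵥ d)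
      + lam ^ 2 * ((d ⬝ᵥ d) * (z ⬝ᵥ z)) := by
    have h1 : M.mulVec z ⬝ᵥ d = ∑ j, ∑ i, M i j * z j * d i := by
      simp only [dotProduct, mulVec, Finset.sum_mul]
      rw [Finset.sum_comm]
    have h2 : (d ⬝ᵥ d) * (z ⬝ᵥ z) = ∑ j, ∑ i, (d i * d i) * (z j * z j) := by
      simp only [dotProduct]
      rw [Finset.sum_mul_sum, Finset.sum_comm]
    rw [h1, h2, hM']
    simp only [trace, diag_apply, mul_apply, transpose_apply, Matrix.sub_apply, Matrix.smul_apply,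
      vecMulVec_apply, smul_eq_mul, Finset.mul_sum]
    simp only [← Finset.sum_sub_distrib, ← Finset.sum_add_distrib]
    refine Finset.sum_congr rfl fun j _ => Finset.sum_congr rfl fun i _ => ?_
    ring
  have hd : 0 ≤ d ⬝ᵥ d := Finset.sum_nonneg fun i _ => mul_self_nonneg (d i)
  rw [key]
  have a1 := mul_le_mul_of_nonneg_left hinner hlam
  have a2 := mul_le_mul_of_nonneg_left hlz (mul_nonneg hlam hd)
  nlinarith [a1, a2]
end

section
/- Under the robust adaptation setting, for every k ≥ 1 the Lyapunov function satisfies the robust descent inequality V_{k+1} ≤ V_k − α λ_k (‖g̃_{k+1} − w*_k‖² + ‖x̃_{k+1} − v*_k‖²). -/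
open Matrix

lemma aux_var {p : ℕ} {S : Set (Fin p → ℝ)} (hS : Convex ℝ S) (a s q : Fin p → ℝ)
    (hs : s ∈ S) (hq : q ∈ S)
    (hmin : ∀ y ∈ S, (a - s) ⬝ᵥ (a - s) ≤ (a - y) ⬝ᵥ (a - y)) :
    (a - s) ⬝ᵥ (q - s) ≤ 0 := by
  by_contra hd
  push Not at hd
  have hN : 0 ≤ (q - s) ⬝ᵥ (q - s) := by
    rw [dotProduct]
    exact Finset.sum_nonneg fun i _ => mul_self_nonneg _
  have key : ∀ t : ℝ, 0 < t → t ≤ 1 →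
      2 * ((a - s) ⬝ᵥ (q - s)) ≤ t * ((q - s) ⬝ᵥ (q - s)) := by
    intro t ht ht1
    have h1 := hmin _ (hS.add_smul_sub_mem hs hq ⟨ht.le, ht1⟩)
    have h2 : a - (s + t • (q - s)) = (a - s) - t • (q - s) := by abel
    rw [h2] at h1
    generalize a - s = e at *
    generalize q - s = f at *
    simp only [sub_dotProduct, dotProduct_sub, smul_dotProduct, dotProduct_smul,
      smul_eq_mul] at h1
    rw [dotProduct_comm f e] at h1
    have h3 : 0 ≤ t * (t * (f ⬝ᵥ f) - 2 * (e ⬝ᵥ f)) := by linarith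
    have := nonneg_of_mul_nonneg_right h3 ht
    linarith
  generalize (a - s) ⬝ᵥ (q - s) = d at *
  generalize (q - s) ⬝ᵥ (q - s) = N at *
  have h1 := key (d / (N + d)) (by positivity) (by rw [div_le_one (by positivity)]; linarith)
  rw [div_mul_eq_mul_div, le_div_iff₀ (by positivity)] at h1
  nlinarith [mul_pos hd hd, mul_nonneg hd.le hN]

lemma aux_trace {p q : ℕ} (A : Matrix (Fin p) (Fin q) ℝ) (l : ℝ) (e : Fin p → ℝ)
    (y : Fin q → ℝ) :
    ((A - l • vecMulVec e y)ᵀ * (A - l • vecMulVec e y)).trace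
      = (Aᵀ * A).trace - 2 * l * (e ⬝ᵥ A.mulVec y) + l ^ 2 * ((e ⬝ᵥ e) * (y ⬝ᵥ y)) := by
  have h1 : (e ⬝ᵥ A.mulVec y) = ∑ j, ∑ i, e i * (A i j * y j) := by
    rw [Finset.sum_comm]
    simp only [dotProduct, mulVec, Finset.mul_sum]
  have h2 : (e ⬝ᵥ e) * (y ⬝ᵥ y) = ∑ j, ∑ i, (e i * e i) * (y j * y j) := by
    rw [Finset.sum_comm]
    simp only [dotProduct, Finset.sum_mul_sum]
  rw [h1, h2]
  simp only [trace, diag_apply, mul_apply, transpose_apply, Matrix.sub_apply, Matrix.smul_apply,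
    vecMulVec_apply, smul_eq_mul, Finset.mul_sum, ← Finset.sum_sub_distrib,
    ← Finset.sum_add_distrib]
  refine Finset.sum_congr rfl fun j _ => Finset.sum_congr rfl fun i _ => ?_
  ring

lemma aux_step {p q : ℕ} {S : Set (Fin p → ℝ)} (hS : Convex ℝ S)
    (A : Matrix (Fin p) (Fin q) ℝ) (l α : ℝ) (a s w : Fin p → ℝ) (y : Fin q → ℝ)
    (hl : 0 ≤ l) (hly : l ≤ (2 - α) / (y ⬝ᵥ y)) (hy : y ≠ 0)
    (ha : A.mulVec y = a - w) (hs : s ∈ S) (hw : w ∈ S)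
    (hmin : ∀ z ∈ S, (a - s) ⬝ᵥ (a - s) ≤ (a - z) ⬝ᵥ (a - z)) :
    ((A - l • vecMulVec (a - s) y)ᵀ * (A - l • vecMulVec (a - s) y)).trace
      ≤ (Aᵀ * A).trace - α * l * ((a - s) ⬝ᵥ (a - s)) := by
  have hv := aux_var hS a s w hs hw hmin
  have hyy : 0 < y ⬝ᵥ y := lt_of_le_of_ne
    (Finset.sum_nonneg fun i _ => mul_self_nonneg _)
    (fun h0 => hy (dotProduct_self_eq_zero.1 h0.symm))
  have he : 0 ≤ (a - s) ⬝ᵥ (a - s) := Finset.sum_nonneg fun i _ => mul_self_nonneg _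
  rw [le_div_iff₀ hyy] at hly
  have h2 : a - w = (a - s) - (w - s) := by abel
  rw [aux_trace, ha, h2, dotProduct_sub]
  have h3 := mul_le_mul_of_nonneg_left hly (mul_nonneg hl he)
  have h4 := mul_nonneg hl (neg_nonneg.2 hv)
  nlinarith


/-- Robust adaptation: the Lyapunov function satisfies the robust descent inequality
`V_{k+1} ≤ V_k − α λ_k (‖g̃_{k+1} − w*_k‖² + ‖x̃_{k+1} − v*_k‖²)` for all `k ≥ 1`. -/
theorem robust_lyapunov_descent
    (h n m : ℕ) (hh : 1 ≤ h) (hn : 1 ≤ n) (hm : 1 ≤ m)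
    (α : ℝ) (hα : 0 < α) (hα2 : α < 2)
    (Ψ : Matrix (Fin h) (Fin (h + m)) ℝ) (C : Matrix (Fin n) (Fin h) ℝ)
    (W : Set (Fin h → ℝ)) (Vs : Set (Fin n → ℝ))
    (hWne : W.Nonempty) (hWcl : IsClosed W) (hWcv : Convex ℝ W)
    (hWbd : Bornology.IsBounded W)
    (hVne : Vs.Nonempty) (hVcl : IsClosed Vs) (hVcv : Convex ℝ Vs)
    (hVbd : Bornology.IsBounded Vs)
    (X : ℕ → Fin (h + m) → ℝ) (g : ℕ → Fin h → ℝ) (x : ℕ → Fin n → ℝ)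
    (w : ℕ → Fin h → ℝ) (v : ℕ → Fin n → ℝ)
    (hw : ∀ k ≥ 1, w k ∈ W) (hv : ∀ k ≥ 1, v k ∈ Vs)
    (hgdyn : ∀ k ≥ 1, g (k + 1) = Ψ.mulVec (X k) + w k)
    (hxdyn : ∀ k ≥ 1, x (k + 1) = C.mulVec (g (k + 1)) + v k)
    (hXne : ∀ k ≥ 1, X k ≠ 0) (hgne : ∀ k ≥ 1, g (k + 1) ≠ 0)
    (Ψhat : ℕ → Matrix (Fin h) (Fin (h + m)) ℝ) (Chat : ℕ → Matrix (Fin n) (Fin h) ℝ)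
    (gt : ℕ → Fin h → ℝ) (xt : ℕ → Fin n → ℝ) (lam : ℕ → ℝ)
    (wstar : ℕ → Fin h → ℝ) (vstar : ℕ → Fin n → ℝ)
    (hgt : ∀ k ≥ 1, gt (k + 1) = g (k + 1) - (Ψhat k).mulVec (X k))
    (hxt : ∀ k ≥ 1, xt (k + 1) = x (k + 1) - (Chat k).mulVec (g (k + 1)))
    (hwstar : ∀ k ≥ 1, wstar k ∈ W) (hvstar : ∀ k ≥ 1, vstar k ∈ Vs)
    (hstarmin : ∀ k ≥ 1, ∀ w' ∈ W, ∀ v' ∈ Vs,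
      (gt (k + 1) - wstar k) ⬝ᵥ (gt (k + 1) - wstar k)
        + (xt (k + 1) - vstar k) ⬝ᵥ (xt (k + 1) - vstar k) ≤
      (gt (k + 1) - w') ⬝ᵥ (gt (k + 1) - w')
        + (xt (k + 1) - v') ⬝ᵥ (xt (k + 1) - v'))
    (hlam : ∀ k ≥ 1, lam k =
      min ((2 - α) / (X k ⬝ᵥ X k)) ((2 - α) / (g (k + 1) ⬝ᵥ g (k + 1))))
    (hΨup : ∀ k ≥ 1, Ψhat (k + 1)
        = Ψhat k + lam k • vecMulVec (gt (k + 1) - wstar k) (X k))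
    (hCup : ∀ k ≥ 1, Chat (k + 1)
        = Chat k + lam k • vecMulVec (xt (k + 1) - vstar k) (g (k + 1)))
    (V : ℕ → ℝ)
    (hV : ∀ k ≥ 1, V k = ((Ψ - Ψhat k)ᵀ * (Ψ - Ψhat k)).trace
        + ((C - Chat k)ᵀ * (C - Chat k)).trace)
    :
    ∀ k ≥ 1, V (k + 1) ≤ V k - α * lam k *
      ((gt (k + 1) - wstar k) ⬝ᵥ (gt (k + 1) - wstar k)
        + (xt (k + 1) - vstar k) ⬝ᵥ (xt (k + 1) - vstar k)) := by
  intro k hk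
  have hl1 : lam k ≤ (2 - α) / (X k ⬝ᵥ X k) := by rw [hlam k hk]; exact min_le_left _ _
  have hl2 : lam k ≤ (2 - α) / (g (k + 1) ⬝ᵥ g (k + 1)) := by
    rw [hlam k hk]; exact min_le_right _ _
  have hl0 : 0 ≤ lam k := by
    rw [hlam k hk]
    exact le_min
      (div_nonneg (by linarith) (Finset.sum_nonneg fun i _ => mul_self_nonneg _))
      (div_nonneg (by linarith) (Finset.sum_nonneg fun i _ => mul_self_nonneg _))
  have s1 := aux_step hWcv (Ψ - Ψhat k) (lam k) α (gt (k + 1)) (wstar k) (w k) (X k)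
    hl0 hl1 (hXne k hk)
    (by rw [hgt k hk, hgdyn k hk, sub_mulVec]; abel) (hwstar k hk) (hw k hk)
    (fun z hz => by linarith [hstarmin k hk z hz _ (hvstar k hk)])
  have s2 := aux_step hVcv (C - Chat k) (lam k) α (xt (k + 1)) (vstar k) (v k) (g (k + 1))
    hl0 hl2 (hgne k hk)
    (by rw [hxt k hk, hxdyn k hk, sub_mulVec]; abel) (hvstar k hk) (hv k hk)
    (fun z hz => by linarith [hstarmin k hk _ (hwstar k hk) z hz])
  rw [hV k hk, hV (k + 1) (by omega), hΨup k hk, hCup k hk, ← sub_sub, ← sub_sub]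
  linarith
end
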